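/- Assume |ξ| ≠ 1/(2βη²γ). Then the restriction of Â(ξ) to the five-dimensional complex subspace E(ξ) is diagonalizable: E(ξ) is the (internal) direct sum of the three eigenspaces E₀(ξ) = span{(ξ, 0)}, E₊(ξ) = {(e, −(i/(γλ₊(ξ))) ξ × e) : e ∈ ℂ³, ξ · e = 0} and E₋(ξ) = {(e, −(i/(γλ₋(ξ))) ξ × e) : e ∈ ℂ³, ξ · e = 0}, corresponding to the eigenvalues λ₀ = −1/(βη²γ²), λ₊(ξ) and λ₋(ξ) respectively. -/

import Mathlib

noncomputable section

open Complex

/-- ℂ³ with the Hermitian (Euclidean) norm. -/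
abbrev V3 : Type := EuclideanSpace ℂ (Fin 3)
/-- ℝ³ with the Euclidean norm. -/
abbrev R3 : Type := EuclideanSpace ℝ (Fin 3)

/-- The cross product, extended ℂ-bilinearly to ℂ³. -/
def cross (a b : V3) : V3 :=
  (WithLp.equiv 2 (Fin 3 → ℂ)).symm
    ![a 1 * b 2 - a 2 * b 1, a 2 * b 0 - a 0 * b 2, a 0 * b 1 - a 1 * b 0]

/-- The dot product, extended ℂ-bilinearly to ℂ³. -/
def dotc (a b : V3) : ℂ := a 0 * b 0 + a 1 * b 1 + a 2 * b 2

/-- The coercion of a real vector to a complex vector. -/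
def toC (ξ : R3) : V3 := (WithLp.equiv 2 (Fin 3 → ℂ)).symm fun j => ((ξ j : ℝ) : ℂ)

/-- The Fourier-side Maxwell operator Â(ξ). -/
def Ahat (β η γ : ℝ) (ξ : R3) (v : V3 × V3) : V3 × V3 :=
  (-(1 / ((β : ℂ) * (η : ℂ) ^ 2 * (γ : ℂ) ^ 2)) • v.1 + (I / (γ : ℂ)) • cross (toC ξ) v.2,
   (-(I / (γ : ℂ))) • cross (toC ξ) v.1)

/-- The eigenvalue λ₀ = −1/(βη²γ²). -/
def lam0 (β η γ : ℝ) : ℂ := -(1 / ((β : ℂ) * (η : ℂ) ^ 2 * (γ : ℂ) ^ 2))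

/-- δ(ξ) = √(1 − 4β²η⁴γ²|ξ|²) if |ξ| ≤ 1/(2βη²γ), and i√(4β²η⁴γ²|ξ|² − 1) otherwise. -/
def deltaF (β η γ : ℝ) (ξ : R3) : ℂ :=
  if ‖ξ‖ ≤ 1 / (2 * β * η ^ 2 * γ) then
    ((Real.sqrt (1 - 4 * β ^ 2 * η ^ 4 * γ ^ 2 * ‖ξ‖ ^ 2) : ℝ) : ℂ)
  else I * ((Real.sqrt (4 * β ^ 2 * η ^ 4 * γ ^ 2 * ‖ξ‖ ^ 2 - 1) : ℝ) : ℂ)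

/-- λ₊(ξ) = (−1 + δ(ξ))/(2βη²γ²). -/
def lamP (β η γ : ℝ) (ξ : R3) : ℂ :=
  (-1 + deltaF β η γ ξ) / (2 * (β : ℂ) * (η : ℂ) ^ 2 * (γ : ℂ) ^ 2)

/-- λ₋(ξ) = (−1 − δ(ξ))/(2βη²γ²). -/
def lamM (β η γ : ℝ) (ξ : R3) : ℂ :=
  (-1 - deltaF β η γ ξ) / (2 * (β : ℂ) * (η : ℂ) ^ 2 * (γ : ℂ) ^ 2)

/-- The eigenspace E₀(ξ) = span{(ξ, 0)}. -/
def E0set (ξ : R3) : Set (V3 × V3) := {v | ∃ c : ℂ, v = (c • toC ξ, 0)}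

/-- The eigenspace E₊(ξ) = {(e, −(i/(γλ₊)) ξ × e) : ξ·e = 0}. -/
def EPset (β η γ : ℝ) (ξ : R3) : Set (V3 × V3) :=
  {v | ∃ e : V3, dotc (toC ξ) e = 0 ∧
    v = (e, (-(I / ((γ : ℂ) * lamP β η γ ξ))) • cross (toC ξ) e)}

/-- The eigenspace E₋(ξ) = {(e, −(i/(γλ₋)) ξ × e) : ξ·e = 0}. -/
def EMset (β η γ : ℝ) (ξ : R3) : Set (V3 × V3) :=
  {v | ∃ e : V3, dotc (toC ξ) e = 0 ∧
    v = (e, (-(I / ((γ : ℂ) * lamM β η γ ξ))) • cross (toC ξ) e)}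

theorem toC_apply (ξ : R3) (j : Fin 3) : toC ξ j = ((ξ j : ℝ) : ℂ) := rfl

theorem cross_smul (x a : V3) (c : ℂ) : cross x (c • a) = c • cross x a := by
  ext j
  fin_cases j <;> simp [cross] <;> ring

theorem cross_add (x a b : V3) : cross x (a + b) = cross x a + cross x b := by
  ext j
  fin_cases j <;> simp [cross] <;> ring

theorem cross_vec_self (x : V3) : cross x x = 0 := by
  ext j
  fin_cases j <;> simp [cross] <;> ring

theorem cross_zero (x : V3) : cross x 0 = 0 := by
  simpa using cross_smul x 0 0

theorem cross_vec_cross (x a : V3) : cross x (cross x a) = dotc x a • x - dotc x x • a := by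
  ext j
  fin_cases j <;> simp [cross, dotc] <;> ring

theorem dotc_smul (x a : V3) (c : ℂ) : dotc x (c • a) = c * dotc x a := by
  simp [dotc]; ring

theorem dotc_add (x a b : V3) : dotc x (a + b) = dotc x a + dotc x b := by
  simp [dotc]; ring

theorem dotc_sub (x a b : V3) : dotc x (a - b) = dotc x a - dotc x b := by
  simp [dotc]; ring

theorem dotc_cross (x a : V3) : dotc x (cross x a) = 0 := by
  simp [dotc, cross]; ring

theorem dotc_toC_self (ξ : R3) : dotc (toC ξ) (toC ξ) = ((‖ξ‖ : ℝ) : ℂ) ^ 2 := by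
  rw [← Complex.ofReal_pow, EuclideanSpace.norm_sq_eq, Fin.sum_univ_three]
  simp [dotc, toC_apply]
  ring

theorem deltaF_sq {β η γ : ℝ} (hβ : 0 < β) (hη : 0 < η) (hγ : 0 < γ) (ξ : R3) :
    deltaF β η γ ξ ^ 2 = 1 - 4 * (β : ℂ) ^ 2 * η ^ 4 * γ ^ 2 * (‖ξ‖ : ℂ) ^ 2 := by
  have hd : 0 < 2 * β * η ^ 2 * γ := by positivity
  have hs : 4 * β ^ 2 * η ^ 4 * γ ^ 2 * ‖ξ‖ ^ 2 = (‖ξ‖ * (2 * β * η ^ 2 * γ)) ^ 2 := by ring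
  have hn : 0 ≤ ‖ξ‖ * (2 * β * η ^ 2 * γ) := by positivity
  unfold deltaF
  split_ifs with hle
  · rw [le_div_iff₀ hd] at hle
    rw [← Complex.ofReal_pow, Real.sq_sqrt (by rw [hs]; nlinarith)]
    push_cast
    ring
  · rw [not_le, div_lt_iff₀ hd] at hle
    rw [mul_pow, I_sq, ← Complex.ofReal_pow, Real.sq_sqrt (by rw [hs]; nlinarith)]
    push_cast
    ring

theorem deltaF_ne_zero {β η γ : ℝ} (hβ : 0 < β) (hη : 0 < η) (hγ : 0 < γ) {ξ : R3}
    (h : ‖ξ‖ ≠ 1 / (2 * β * η ^ 2 * γ)) : deltaF β η γ ξ ≠ 0 := by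
  intro h0
  have hd : 0 < 2 * β * η ^ 2 * γ := by positivity
  have h1 := deltaF_sq hβ hη hγ ξ
  rw [h0] at h1
  have h2 : (0 : ℝ) ^ 2 = 1 - 4 * β ^ 2 * η ^ 4 * γ ^ 2 * ‖ξ‖ ^ 2 := by exact_mod_cast h1
  apply h
  rw [eq_div_iff hd.ne', ← pow_left_inj₀ (by positivity) zero_le_one two_ne_zero]
  linarith

/-- The characteristic equation satisfied by both nontrivial eigenvalues. -/
theorem charpoly_root {β η γ d n : ℂ} (hβ : β ≠ 0) (hη : η ≠ 0) (hγ : γ ≠ 0)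
    (hd : d ^ 2 = 1 - 4 * β ^ 2 * η ^ 4 * γ ^ 2 * n) :
    ((-1 + d) / (2 * β * η ^ 2 * γ ^ 2)) ^ 2
      + (1 / (β * η ^ 2 * γ ^ 2)) * ((-1 + d) / (2 * β * η ^ 2 * γ ^ 2)) + n / γ ^ 2 = 0 := by
  field_simp
  linear_combination hd

theorem Ahat_eigenvector {β η γ : ℝ} (hγ : γ ≠ 0) {ξ : R3} {l : ℂ} (hl : l ≠ 0)
    (hroot : l ^ 2 + (1 / ((β : ℂ) * (η : ℂ) ^ 2 * (γ : ℂ) ^ 2)) * l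
      + (‖ξ‖ : ℂ) ^ 2 / (γ : ℂ) ^ 2 = 0)
    {e : V3} (he : dotc (toC ξ) e = 0) :
    Ahat β η γ ξ (e, (-(I / ((γ : ℂ) * l))) • cross (toC ξ) e) =
      l • (e, (-(I / ((γ : ℂ) * l))) • cross (toC ξ) e) := by
  have hγ' : (γ : ℂ) ≠ 0 := by exact_mod_cast hγ
  generalize hk : 1 / ((β : ℂ) * (η : ℂ) ^ 2 * (γ : ℂ) ^ 2) = k at hroot
  simp only [Ahat, hk, cross_smul, cross_vec_cross, he, dotc_toC_self, Prod.smul_mk, Prod.mk.injEq]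
  refine ⟨?_, ?_⟩
  · have hs : -k + (I / γ) * (-(I / (γ * l))) * (-(‖ξ‖ : ℂ) ^ 2) = l := by
      field_simp at hroot ⊢
      rw [I_sq]
      linear_combination -hroot
    conv_rhs => rw [← hs]
    module
  · rw [smul_smul]
    congr 1
    field_simp

theorem existsUnique_eigen_decomposition {x : V3} (hx : dotc x x ≠ 0) {k p m : ℂ} (hk : k ≠ 0)
    (hp : p ≠ 0) (hm : m ≠ 0) (hpm : p - m ≠ 0) (v : V3 × V3) (hv : dotc x v.2 = 0) :
    ∃! w : (V3 × V3) × (V3 × V3) × (V3 × V3),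
      (∃ c : ℂ, w.1 = (c • x, 0)) ∧
      (∃ e, dotc x e = 0 ∧ w.2.1 = (e, (-(k / p)) • cross x e)) ∧
      (∃ e, dotc x e = 0 ∧ w.2.2 = (e, (-(k / m)) • cross x e)) ∧
      v = w.1 + w.2.1 + w.2.2 := by
  obtain ⟨e, b⟩ := v
  simp only at hv
  set S := dotc x x with hS
  set c := dotc x e / S with hc
  set g : V3 := e - c • x with hg
  set f : V3 := (1 / (k * S)) • cross x b with hf
  have hxg : dotc x g = 0 := by
    rw [hg, dotc_sub, dotc_smul, hc]; field_simp; simp [hS]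
  have hxf : dotc x f = 0 := by rw [hf, dotc_smul, dotc_cross, mul_zero]
  set u : V3 := (p / (p - m)) • (g - m • f) with hu
  set w : V3 := (m / (p - m)) • (p • f - g) with hw
  have hxu : dotc x u = 0 := by simp [hu, dotc_smul, dotc_sub, hxg, hxf]
  have hxw : dotc x w = 0 := by simp [hw, dotc_smul, dotc_sub, hxg, hxf]
  have huw : u + w = g := by
    rw [hu, hw]
    match_scalars <;> field_simp <;> ring
  have huwf : (1 / p) • u + (1 / m) • w = f := by
    rw [hu, hw]
    match_scalars <;> field_simp <;> ring
  clear_value u w f g c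
  refine ⟨((c • x, 0), (u, (-(k / p)) • cross x u), (w, (-(k / m)) • cross x w)),
    ⟨⟨c, rfl⟩, ⟨u, hxu, rfl⟩, ⟨w, hxw, rfl⟩, ?_⟩, ?_⟩
  · simp only [Prod.mk_add_mk, Prod.mk.injEq]
    refine ⟨by rw [add_assoc, huw, hg]; module, ?_⟩
    have h1 : (-(k / p)) • cross x u + (-(k / m)) • cross x w = (-k) • cross x f := by
      rw [← huwf, cross_add, cross_smul, cross_smul]
      module
    rw [zero_add, h1, hf, cross_smul, cross_vec_cross, hv, ← hS, zero_smul, zero_sub]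
    match_scalars
    field_simp
  · rintro ⟨w₀, w₁, w₂⟩ ⟨⟨c', h₀⟩, ⟨u', hu', h₁⟩, ⟨w', hw', h₂⟩, hsum⟩
    simp only at h₀ h₁ h₂ hsum
    subst h₀ h₁ h₂
    simp only [Prod.mk_add_mk, Prod.mk.injEq, zero_add] at hsum
    obtain ⟨he, hb⟩ := hsum
    have hcc : c' = c := by
      rw [hc, he, dotc_add, dotc_add, dotc_smul, hu', hw', ← hS]
      field_simp
      ring
    have hg' : g = u' + w' := by
      rw [hg, ← hcc, he]; module
    have hf' : f = (1 / p) • u' + (1 / m) • w' := by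
      rw [hf, hb, cross_add, cross_smul, cross_smul, cross_vec_cross, cross_vec_cross, hu', hw', ← hS,
        zero_smul, zero_sub, zero_sub]
      match_scalars <;> field_simp
    have huu : u' = u := by
      rw [hu, hg', hf']
      match_scalars <;> field_simp <;> ring
    have hww : w' = w := by
      rw [hw, hg', hf']
      match_scalars <;> field_simp <;> ring
    rw [hcc, huu, hww]

/-- if |ξ| ≠ 1/(2βη²γ), the restriction of Â(ξ) to E(ξ) is diagonalizable:
E₀(ξ), E₊(ξ), E₋(ξ) consist of eigenvectors for λ₀, λ₊(ξ), λ₋(ξ) respectively, and E(ξ) is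
their internal direct sum (every element of E(ξ) decomposes uniquely as a sum of elements
of these three eigenspaces). -/
theorem Ahat_diagonalizable (β η γ : ℝ) (hβ : 0 < β) (hη : 0 < η) (hγ : 0 < γ)
    (ξ : R3) (hξ : ξ ≠ 0) (h : ‖ξ‖ ≠ 1 / (2 * β * η ^ 2 * γ)) :
    (∀ v ∈ E0set ξ, Ahat β η γ ξ v = lam0 β η γ • v) ∧
    (∀ v ∈ EPset β η γ ξ, Ahat β η γ ξ v = lamP β η γ ξ • v) ∧
    (∀ v ∈ EMset β η γ ξ, Ahat β η γ ξ v = lamM β η γ ξ • v) ∧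
    ∀ v : V3 × V3, dotc (toC ξ) v.2 = 0 →
      ∃! w : (V3 × V3) × (V3 × V3) × (V3 × V3),
        w.1 ∈ E0set ξ ∧ w.2.1 ∈ EPset β η γ ξ ∧ w.2.2 ∈ EMset β η γ ξ ∧
        v = w.1 + w.2.1 + w.2.2 := by
  have hβ' : (β : ℂ) ≠ 0 := by exact_mod_cast hβ.ne'
  have hη' : (η : ℂ) ≠ 0 := by exact_mod_cast hη.ne'
  have hγ' : (γ : ℂ) ≠ 0 := by exact_mod_cast hγ.ne'
  have hn : (‖ξ‖ : ℂ) ≠ 0 := by exact_mod_cast norm_ne_zero_iff.mpr hξ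
  have hS : dotc (toC ξ) (toC ξ) ≠ 0 := by
    rw [dotc_toC_self]; exact pow_ne_zero 2 hn
  have hδ := deltaF_sq hβ hη hγ ξ
  have hrP : lamP β η γ ξ ^ 2 + (1 / ((β : ℂ) * (η : ℂ) ^ 2 * (γ : ℂ) ^ 2)) * lamP β η γ ξ
      + (‖ξ‖ : ℂ) ^ 2 / (γ : ℂ) ^ 2 = 0 := charpoly_root hβ' hη' hγ' hδ
  have hrM : lamM β η γ ξ ^ 2 + (1 / ((β : ℂ) * (η : ℂ) ^ 2 * (γ : ℂ) ^ 2)) * lamM β η γ ξ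
      + (‖ξ‖ : ℂ) ^ 2 / (γ : ℂ) ^ 2 = 0 :=
    charpoly_root (d := -deltaF β η γ ξ) hβ' hη' hγ' (by rw [neg_sq, hδ])
  have hP : lamP β η γ ξ ≠ 0 := fun h0 => by simp [h0, hn, hγ'] at hrP
  have hM : lamM β η γ ξ ≠ 0 := fun h0 => by simp [h0, hn, hγ'] at hrM
  have hPM : lamP β η γ ξ - lamM β η γ ξ ≠ 0 := by
    have h1 : lamP β η γ ξ - lamM β η γ ξ
        = deltaF β η γ ξ / ((β : ℂ) * (η : ℂ) ^ 2 * (γ : ℂ) ^ 2) := by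
      unfold lamP lamM
      field_simp
      ring
    rw [h1]
    exact div_ne_zero (deltaF_ne_zero hβ hη hγ h) (by simp [hβ', hη', hγ'])
  refine ⟨?_, ?_, ?_, fun v hv => ?_⟩
  · rintro _ ⟨c, rfl⟩
    simp [Ahat, lam0, cross_smul, cross_vec_self, cross_zero]
  · rintro _ ⟨e, he, rfl⟩
    exact Ahat_eigenvector hγ.ne' hP hrP he
  · rintro _ ⟨e, he, rfl⟩
    exact Ahat_eigenvector hγ.ne' hM hrM he
  · have key := existsUnique_eigen_decomposition hS (div_ne_zero I_ne_zero hγ') hP hM hPM v hv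
    simpa only [E0set, EPset, EMset, Set.mem_ofPred_eq, ← div_div] using key
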